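/- Let μ, ν, ρ be finite complex measures on ℝ. If μ * ρ = ν * ρ (convolution of measures) and the Fourier transform (characteristic function) of ρ is nonzero everywhere, then μ = ν. -/

import Mathlib

open Complex

noncomputable section

namespace MeasureTheory

/-- The positive part of the real part of a complex measure, a finite measure. -/
def ComplexMeasure.posRe (μ : ComplexMeasure ℝ) : Measure ℝ :=
  (ComplexMeasure.re μ).toJordanDecomposition.posPart

/-- The negative part of the real part of a complex measure, a finite measure. -/
def ComplexMeasure.negRe (μ : ComplexMeasure ℝ) : Measure ℝ :=
  (ComplexMeasure.re μ).toJordanDecomposition.negPart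

/-- The positive part of the imaginary part of a complex measure, a finite measure. -/
def ComplexMeasure.posIm (μ : ComplexMeasure ℝ) : Measure ℝ :=
  (ComplexMeasure.im μ).toJordanDecomposition.posPart

/-- The negative part of the imaginary part of a complex measure, a finite measure. -/
def ComplexMeasure.negIm (μ : ComplexMeasure ℝ) : Measure ℝ :=
  (ComplexMeasure.im μ).toJordanDecomposition.negPart

instance (μ : ComplexMeasure ℝ) : IsFiniteMeasure μ.posRe := by
  unfold ComplexMeasure.posRe; infer_instance
instance (μ : ComplexMeasure ℝ) : IsFiniteMeasure μ.negRe := by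
  unfold ComplexMeasure.negRe; infer_instance
instance (μ : ComplexMeasure ℝ) : IsFiniteMeasure μ.posIm := by
  unfold ComplexMeasure.posIm; infer_instance
instance (μ : ComplexMeasure ℝ) : IsFiniteMeasure μ.negIm := by
  unfold ComplexMeasure.negIm; infer_instance

/-- Integral of a function against a complex measure, via the Jordan decompositions of its
real and imaginary parts. -/
def ComplexMeasure.integral (μ : ComplexMeasure ℝ) (f : ℝ → ℂ) : ℂ :=
  ((∫ t, f t ∂μ.posRe) - (∫ t, f t ∂μ.negRe))
    + Complex.I * ((∫ t, f t ∂μ.posIm) - (∫ t, f t ∂μ.negIm))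

/-- The Fourier transform (characteristic function) of a complex measure:
`ρ̂(ω) = ∫ exp (-i ω t) dρ(t)`. -/
def ComplexMeasure.fourier (μ : ComplexMeasure ℝ) (ω : ℝ) : ℂ :=
  μ.integral fun t => Complex.exp (-(ω * t) * Complex.I)

/-- Convolution of two finite complex measures, defined by bilinearly extending the additive
convolution of finite (nonnegative) measures to the Jordan parts, mimicking multiplication of
the complex decompositions `(a - b) + i (c - d)`. -/
def ComplexMeasure.conv (μ ν : ComplexMeasure ℝ) : ComplexMeasure ℝ :=
  MeasureTheory.SignedMeasure.toComplexMeasure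
    ((((μ.posRe.conv ν.posRe + μ.negRe.conv ν.negRe)
        + (μ.posIm.conv ν.negIm + μ.negIm.conv ν.posIm)).toSignedMeasure)
      - (((μ.posRe.conv ν.negRe + μ.negRe.conv ν.posRe)
        + (μ.posIm.conv ν.posIm + μ.negIm.conv ν.negIm)).toSignedMeasure))
    ((((μ.posRe.conv ν.posIm + μ.negRe.conv ν.negIm)
        + (μ.posIm.conv ν.posRe + μ.negIm.conv ν.negRe)).toSignedMeasure)
      - (((μ.posRe.conv ν.negIm + μ.negRe.conv ν.posIm)
        + (μ.posIm.conv ν.negRe + μ.negIm.conv ν.posRe)).toSignedMeasure))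

end MeasureTheory

open MeasureTheory

namespace MeasureTheory

open scoped ComplexConjugate

/-- The characteristic function is additive on finite measures. -/
lemma charFun_add_measure (μ ν : Measure ℝ) [IsFiniteMeasure μ] [IsFiniteMeasure ν] (t : ℝ) :
    charFun (μ + ν) t = charFun μ t + charFun ν t := by
  simp only [charFun_eq_integral_innerProbChar]
  exact integral_add_measure (BoundedContinuousFunction.integrable _ _)
    (BoundedContinuousFunction.integrable _ _)

/-- Differences of finite measures are determined by the differences of the characteristic
functions. -/
lemma toSignedMeasure_sub_eq_iff_charFun (a b c d : Measure ℝ) [IsFiniteMeasure a]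
    [IsFiniteMeasure b] [IsFiniteMeasure c] [IsFiniteMeasure d] :
    a.toSignedMeasure - b.toSignedMeasure = c.toSignedMeasure - d.toSignedMeasure ↔
      ∀ t, charFun a t - charFun b t = charFun c t - charFun d t := by
  simp only [sub_eq_sub_iff_add_eq_add, ← charFun_add_measure, ← Measure.toSignedMeasure_add,
    Measure.toSignedMeasure_eq_toSignedMeasure_iff]
  exact ⟨fun h t ↦ by rw [h], fun h ↦ Measure.ext_of_charFun (funext h)⟩

namespace ComplexMeasure

lemma fourier_eq_charFun (μ : ComplexMeasure ℝ) (ω : ℝ) :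
    μ.fourier ω = (charFun μ.posRe (-ω) - charFun μ.negRe (-ω))
      + I * (charFun μ.posIm (-ω) - charFun μ.negIm (-ω)) := by
  simp only [fourier, integral, charFun_apply_real, ofReal_neg, neg_mul]

lemma toSignedMeasure_posRe_sub_negRe (μ : ComplexMeasure ℝ) :
    μ.posRe.toSignedMeasure - μ.negRe.toSignedMeasure = re μ :=
  SignedMeasure.toSignedMeasure_toJordanDecomposition _

lemma toSignedMeasure_posIm_sub_negIm (μ : ComplexMeasure ℝ) :
    μ.posIm.toSignedMeasure - μ.negIm.toSignedMeasure = im μ :=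
  SignedMeasure.toSignedMeasure_toJordanDecomposition _

/-- A complex measure on `ℝ` is determined by its Fourier transform. -/
theorem ext_of_fourier {μ ν : ComplexMeasure ℝ} (h : ∀ ω, μ.fourier ω = ν.fourier ω) :
    μ = ν := by
  simp only [fourier_eq_charFun] at h
  have key (t : ℝ) := h (-t)
  have key_conj (t : ℝ) := congrArg conj (h t)
  simp only [neg_neg] at key
  simp only [charFun_neg, map_add, map_sub, map_mul, conj_conj, conj_I] at key_conj
  apply equivSignedMeasure.injective
  refine Prod.ext ?_ ?_
  · change re μ = re ν
    rw [← toSignedMeasure_posRe_sub_negRe, ← toSignedMeasure_posRe_sub_negRe,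
      toSignedMeasure_sub_eq_iff_charFun]
    intro t
    linear_combination (key t + key_conj t) / 2
  · change im μ = im ν
    rw [← toSignedMeasure_posIm_sub_negIm, ← toSignedMeasure_posIm_sub_negIm,
      toSignedMeasure_sub_eq_iff_charFun]
    intro t
    refine mul_left_cancel₀ I_ne_zero ?_
    linear_combination (key t - key_conj t) / 2

/-- If two convolutions with `ρ` agree, then so do the corresponding products of Fourier
transforms. -/
lemma fourier_mul_fourier_eq_of_conv_eq {μ ν ρ : ComplexMeasure ℝ} (h : μ.conv ρ = ν.conv ρ)
    (ω : ℝ) : μ.fourier ω * ρ.fourier ω = ν.fourier ω * ρ.fourier ω := by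
  have hre := congrArg re h
  have him := congrArg im h
  simp only [conv, SignedMeasure.re_toComplexMeasure] at hre
  simp only [conv, SignedMeasure.im_toComplexMeasure] at him
  rw [toSignedMeasure_sub_eq_iff_charFun] at hre him
  specialize hre (-ω)
  specialize him (-ω)
  simp only [charFun_add_measure, charFun_conv] at hre him
  simp only [fourier_eq_charFun]
  linear_combination hre + I * him
    + ((charFun μ.posIm (-ω) - charFun μ.negIm (-ω)
        - (charFun ν.posIm (-ω) - charFun ν.negIm (-ω)))
      * (charFun ρ.posIm (-ω) - charFun ρ.negIm (-ω))) * I_mul_I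

end ComplexMeasure

end MeasureTheory

/-- **Deconvolution of complex measures.** If `μ * ρ = ν * ρ` as (finite) complex measures on `ℝ`
and the Fourier transform of `ρ` vanishes nowhere, then `μ = ν`. -/
theorem MeasureTheory.ComplexMeasure.eq_of_conv_eq_of_fourier_ne_zero
    (μ ν ρ : ComplexMeasure ℝ)
    (h : μ.conv ρ = ν.conv ρ)
    (hρ : ∀ ω : ℝ, ρ.fourier ω ≠ 0) :
    μ = ν := by
  refine ComplexMeasure.ext_of_fourier fun ω ↦ mul_right_cancel₀ (hρ ω) ?_
  exact ComplexMeasure.fourier_mul_fourier_eq_of_conv_eq h ω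

end
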